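/- arXiv:2407.16093 — 2 statements merged into one kernel-verified Lean document; each statement's English description precedes it below -/
import Mathlib

section
/- Mutual linear-affine dependence of two output currents: for any two ordered pairs e = (u,v) and e' = (u',v') of distinct vertices there exist real numbers α, β, γ, independent of p and m, with (β, γ) ≠ (0, 0), such that β·j_e(p,m) + γ·j_{e'}(p,m) = α for all p, m ≥ 0. -/
open scoped Classical

noncomputable section

/-- A rooted spanning tree with root `x`: a map `t : X → X` fixing `x` such that every
vertex reaches `x` under iteration of `t`. -/
def IsRootedTree {X : Type*} (x : X) (t : X → X) : Prop :=
  t x = x ∧ ∀ y : X, ∃ n : ℕ, t^[n] y = x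

/-- The edge set of a rooted spanning tree: `{(y, t y) : y ≠ x}`. -/
def treeEdges {X : Type*} (x : X) (t : X → X) : Set (X × X) :=
  {p : X × X | p.1 ≠ x ∧ p.2 = t p.1}

/-- The weight of a rooted spanning tree: `∏_{y ≠ x} r (y, t y)`. -/
def treeWeight {X : Type*} [Fintype X] (r : X × X → ℝ) (x : X) (t : X → X) : ℝ :=
  ∏ y ∈ Finset.univ.filter (fun y => y ≠ x), r (y, t y)

/-- The conditioned rooted spanning-tree polynomial `τ_x^{∖A ∥B}`: the sum of weights of
rooted spanning trees with root `x` avoiding all edges of `A` and containing all edges of `B`. -/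
def tau {X : Type*} [Fintype X] (r : X × X → ℝ) (x : X) (A B : Set (X × X)) : ℝ :=
  ∑ t : X → X,
    if IsRootedTree x t ∧ treeEdges x t ∩ A = ∅ ∧ B ⊆ treeEdges x t
    then treeWeight r x t else 0

/-- Irreducibility: between any two distinct vertices there is a directed path of
present (positive-rate) edges. -/
def Irreducible' {X : Type*} (r : X × X → ℝ) : Prop :=
  ∀ x y : X, x ≠ y → ∃ (n : ℕ) (f : ℕ → X),
    f 0 = x ∧ f n = y ∧ ∀ i < n, 0 < r (f i, f (i + 1))

/-- The rate function with the pinned rates `r(a,b) = p` and `r(b,a) = m` substituted. -/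
def ratePM {X : Type*} (r : X × X → ℝ) (a b : X) (p m : ℝ) : X × X → ℝ :=
  fun e => if e = (a, b) then p else if e = (b, a) then m else r e

/-- The stationary current through the ordered pair `(u,v)`:
`(r(u,v) τ_u − r(v,u) τ_v) / Σ_x τ_x`. -/
def current {X : Type*} [Fintype X] (r : X × X → ℝ) (u v : X) : ℝ :=
  (r (u, v) * tau r u ∅ ∅ - r (v, u) * tau r v ∅ ∅) / ∑ x, tau r x ∅ ∅

def Reach {X : Type*} (f : X → X) (x : X) : Prop := ∀ z, ∃ n : ℕ, f^[n] z = x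

theorem iter_agree {X : Type*} (f g : X → X) (y : X) (h : ∀ z, z ≠ y → f z = g z) :
    ∀ (n : ℕ) (z : X), f^[n] z = y → ∃ k, g^[k] z = y := by
  intro n
  induction n with
  | zero => intro z hz; exact ⟨0, hz⟩
  | succ n ih =>
    intro z hz
    by_cases hzy : z = y
    · exact ⟨0, hzy⟩
    · rw [Function.iterate_succ_apply] at hz
      obtain ⟨k, hk⟩ := ih _ hz
      refine ⟨k + 1, ?_⟩
      rw [Function.iterate_succ_apply, ← h z hzy]
      exact hk

theorem reach_congr {X : Type*} (f g : X → X) (y : X) (h : ∀ z, z ≠ y → f z = g z)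
    (hf : Reach f y) : Reach g y := by
  intro z
  obtain ⟨n, hn⟩ := hf z
  exact iter_agree f g y h n z hn

theorem reach_update {X : Type*} (f : X → X) (y w : X) (hf : Reach f y) :
    Reach (Function.update f y w) y := by
  apply reach_congr f _ y _ hf
  intro z hz
  simp [Function.update_of_ne hz]

theorem tau_eq {X : Type*} [Fintype X] (r : X × X → ℝ) (x : X) :
    tau r x ∅ ∅ = ∑ t ∈ Finset.univ.filter (fun t : X → X => t x = x ∧ Reach t x),
      treeWeight r x t := by
  rw [Finset.sum_filter]
  unfold tau
  apply Finset.sum_congr rfl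
  intro t _
  simp [IsRootedTree, Reach]
  congr

theorem weight_split {X : Type*} [Fintype X] (r : X × X → ℝ) (y : X) (f : X → X) :
    ∏ z, r (z, f z) = r (y, f y) * treeWeight r y f := by
  unfold treeWeight
  rw [Finset.filter_ne' Finset.univ y, Finset.mul_prod_erase _ (fun z => r (z, f z)) (Finset.mem_univ y)]

theorem tau_mul {X : Type*} [Fintype X] (r : X × X → ℝ) (y x : X) :
    r (y, x) * tau r y ∅ ∅ =
      ∑ f ∈ Finset.univ.filter (fun f : X → X => f y = x ∧ Reach f y), ∏ z, r (z, f z) := by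
  rw [tau_eq, Finset.mul_sum]
  refine Finset.sum_bij' (fun t _ => Function.update t y x) (fun f _ => Function.update f y y)
    ?_ ?_ ?_ ?_ ?_
  · intro t ht
    simp only [Finset.mem_filter, Finset.mem_univ, true_and] at ht ⊢
    exact ⟨by simp, reach_update _ _ _ ht.2⟩
  · intro t ht
    simp only [Finset.mem_filter, Finset.mem_univ, true_and] at ht ⊢
    exact ⟨by simp, reach_update _ _ _ ht.2⟩
  · intro t ht
    simp only [Finset.mem_filter, Finset.mem_univ, true_and] at ht
    simp only [Function.update_idem]
    conv_rhs => rw [← Function.update_eq_self y t, ht.1]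
  · intro t ht
    simp only [Finset.mem_filter, Finset.mem_univ, true_and] at ht
    simp only [Function.update_idem]
    conv_rhs => rw [← Function.update_eq_self y t, ht.1]
  · intro t ht
    rw [weight_split r y]
    simp only [Function.update_self]
    congr 1
    unfold treeWeight
    apply Finset.prod_congr rfl
    intro z hz
    simp only [Finset.mem_filter, Finset.mem_univ, true_and] at hz
    rw [Function.update_of_ne hz]

theorem pred_unique {X : Type*} [Fintype X] (f : X → X) (x : X) :
    (Finset.univ.filter (fun y : X => f y = x ∧ Reach f y)).card = if Reach f x then 1 else 0 := by
  split_ifs with h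
  · rw [Finset.card_eq_one]
    obtain ⟨n, hn⟩ := h (f x)
    have hper : ∀ y, f y = x → Reach f y → y ∈ Function.periodicPts f := by
      intro y h1 h2
      obtain ⟨k, hk⟩ := h2 x
      refine ⟨k + 1, Nat.succ_pos _, ?_⟩
      show f^[k + 1] y = y
      rw [Function.iterate_succ_apply, h1, hk]
    have h1 : f (f^[n] x) = x := by
      rw [← Function.iterate_succ_apply' f n x, Function.iterate_succ_apply]; exact hn
    have h2 : Reach f (f^[n] x) := by
      intro z
      obtain ⟨k, hk⟩ := h z
      exact ⟨n + k, by rw [Function.iterate_add_apply, hk]⟩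
    refine ⟨f^[n] x, ?_⟩
    ext y
    simp only [Finset.mem_filter, Finset.mem_univ, true_and, Finset.mem_singleton]
    constructor
    · rintro ⟨h3, h4⟩
      exact (Function.bijOn_periodicPts f).injOn (hper y h3 h4) (hper _ h1 h2) (h3.trans h1.symm)
    · rintro rfl
      exact ⟨h1, h2⟩
  · rw [Finset.card_eq_zero, Finset.filter_eq_empty_iff]
    rintro y - ⟨h1, h2⟩
    apply h
    intro z
    obtain ⟨k, hk⟩ := h2 z
    exact ⟨k + 1, by rw [Function.iterate_succ_apply', hk, h1]⟩

theorem tau_stationary {X : Type*} [Fintype X] (r : X × X → ℝ) (x : X) :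
    ∑ y, (r (y, x) * tau r y ∅ ∅ - r (x, y) * tau r x ∅ ∅) = 0 := by
  rw [Finset.sum_sub_distrib, sub_eq_zero]
  simp only [tau_mul, Finset.sum_filter]
  rw [Finset.sum_comm]
  conv_rhs => rw [Finset.sum_comm]
  apply Finset.sum_congr rfl
  intro f _
  rw [← Finset.sum_filter, Finset.sum_const, pred_unique]
  by_cases h : Reach f x <;> simp [h]

theorem irr_prop {X : Type*} (r : X × X → ℝ) (hi : Irreducible' r) (P : X → Prop)
    (hP : ∀ x y, 0 < r (y, x) → P x → P y) (x : X) (hx : P x) (y : X) : P y := by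
  by_cases hxy : y = x
  · exact hxy ▸ hx
  obtain ⟨n, f, h0, hn, hf⟩ := hi y x hxy
  have : ∀ k ≤ n, P (f (n - k)) := by
    intro k
    induction k with
    | zero => intro _; simpa [hn] using hx
    | succ k ih =>
      intro hk
      apply hP (f (n - k)) _ _ (ih (by omega))
      have := hf (n - (k + 1)) (by omega)
      rwa [show n - (k + 1) + 1 = n - k by omega] at this
  have := this n le_rfl
  simpa [h0] using this

theorem ker_nonneg {X : Type*} [Fintype X] (r : X × X → ℝ) (hr : ∀ e, 0 ≤ r e)
    (hi : Irreducible' r) (h : X → ℝ) (h0 : ∀ x, 0 ≤ h x)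
    (hk : ∀ x, ∑ y, (r (y, x) * h y - r (x, y) * h x) = 0) (x : X) (hx : h x = 0) (y : X) :
    h y = 0 := by
  apply irr_prop r hi (fun z => h z = 0) _ x hx
  intro x y hxy hx
  have := hk x
  simp only [hx, mul_zero, sub_zero] at this
  rw [Finset.sum_eq_zero_iff_of_nonneg (fun z _ => mul_nonneg (hr _) (h0 z))] at this
  have := this y (Finset.mem_univ _)
  rcases mul_eq_zero.1 this with h | h
  · linarith
  · exact h

theorem ker_abs {X : Type*} [Fintype X] (r : X × X → ℝ) (hr : ∀ e, 0 ≤ r e)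
    (g : X → ℝ) (hk : ∀ x, ∑ y, (r (y, x) * g y - r (x, y) * g x) = 0) (x : X) :
    ∑ y, (r (y, x) * |g y| - r (x, y) * |g x|) = 0 := by
  have hnn : ∀ x ∈ Finset.univ, 0 ≤ ∑ y, (r (y, x) * |g y| - r (x, y) * |g x|) := by
    intro x _
    have h1 := hk x
    rw [Finset.sum_sub_distrib, sub_eq_zero] at h1
    rw [Finset.sum_sub_distrib, sub_nonneg]
    calc ∑ y, r (x, y) * |g x| = |∑ y, r (x, y) * g x| := by
          rw [← Finset.sum_mul, ← Finset.sum_mul, abs_mul,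
            abs_of_nonneg (Finset.sum_nonneg (fun y _ => hr _))]
      _ = |∑ y, r (y, x) * g y| := by rw [h1]
      _ ≤ ∑ y, |r (y, x) * g y| := Finset.abs_sum_le_sum_abs _ _
      _ = _ := by simp only [abs_mul, abs_of_nonneg (hr _)]
  have hs : ∑ x, ∑ y, (r (y, x) * |g y| - r (x, y) * |g x|) = 0 := by
    simp only [Finset.sum_sub_distrib]
    rw [Finset.sum_comm, sub_self]
  exact (Finset.sum_eq_zero_iff_of_nonneg hnn).1 hs x (Finset.mem_univ _)

theorem ker_zero {X : Type*} [Fintype X] (r : X × X → ℝ) (hr : ∀ e, 0 ≤ r e)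
    (hi : Irreducible' r) (g : X → ℝ)
    (hk : ∀ x, ∑ y, (r (y, x) * g y - r (x, y) * g x) = 0) (hs : ∑ x, g x = 0) (x : X) :
    g x = 0 := by
  have ha := ker_abs r hr g hk
  rcases le_total 0 (g x) with hx | hx
  · have h1 := ker_nonneg r hr hi (fun y => |g y| - g y)
      (fun y => sub_nonneg.2 (le_abs_self _)) (fun z => by
        have := congrArg₂ (· - ·) (ha z) (hk z)
        simp only [← Finset.sum_sub_distrib, sub_zero] at this
        rw [← this]
        apply Finset.sum_congr rfl; intros; ring) x (by simp [abs_of_nonneg hx])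
    have h2 : ∀ y ∈ Finset.univ, 0 ≤ g y := fun y _ => by
      have := h1 y; linarith [abs_nonneg (g y)]
    exact (Finset.sum_eq_zero_iff_of_nonneg h2).1 hs x (Finset.mem_univ _)
  · have h1 := ker_nonneg r hr hi (fun y => |g y| + g y)
      (fun y => by linarith [neg_abs_le (g y)]) (fun z => by
        have := congrArg₂ (· + ·) (ha z) (hk z)
        simp only [← Finset.sum_add_distrib, add_zero] at this
        rw [← this]
        apply Finset.sum_congr rfl; intros; ring) x (by simp [abs_of_nonpos hx])
    have h2 : ∀ y ∈ Finset.univ, g y ≤ 0 := fun y _ => by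
      have := h1 y; linarith [abs_nonneg (g y)]
    exact (Finset.sum_eq_zero_iff_of_nonpos h2).1 hs x (Finset.mem_univ _)

theorem exists_tree {X : Type*} (r : X × X → ℝ) (hi : Irreducible' r) (x : X) :
    ∃ t : X → X, t x = x ∧ Reach t x ∧ ∀ y, y ≠ x → 0 < r (y, t y) := by
  have hex : ∀ y, ∃ (n : ℕ) (f : ℕ → X),
      f 0 = y ∧ f n = x ∧ ∀ i < n, 0 < r (f i, f (i + 1)) := by
    intro y
    by_cases h : y = x
    · exact ⟨0, fun _ => x, h.symm, rfl, by simp⟩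
    · exact hi y x h
  have step : ∀ y, ∃ w, (y = x → w = x) ∧
      (y ≠ x → 0 < r (y, w) ∧ Nat.find (hex w) < Nat.find (hex y)) := by
    intro y
    by_cases h : y = x
    · exact ⟨x, fun _ => rfl, fun h' => absurd h h'⟩
    obtain ⟨f, h0, hn, hf⟩ := Nat.find_spec (hex y)
    set n := Nat.find (hex y) with hnd
    have hn0 : n ≠ 0 := by
      intro h'
      rw [h'] at hn
      exact h (h0.symm.trans hn)
    refine ⟨f 1, fun h' => absurd h' h, fun _ => ⟨?_, ?_⟩⟩
    · have := hf 0 (by omega)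
      rwa [h0] at this
    · have : Nat.find (hex (f 1)) ≤ n - 1 := by
        apply Nat.find_min'
        refine ⟨fun i => f (i + 1), rfl, ?_, fun i hi => hf (i + 1) (by omega)⟩
        simp only
        rw [Nat.sub_add_cancel (by omega)]
        exact hn
      omega
  choose t ht1 ht2 using step
  refine ⟨t, ht1 x rfl, ?_, fun y hy => (ht2 y hy).1⟩
  have : ∀ N y, Nat.find (hex y) ≤ N → ∃ n : ℕ, t^[n] y = x := by
    intro N
    induction N with
    | zero =>
      intro y hy
      by_cases h : y = x
      · exact ⟨0, h⟩
      · have := (ht2 y h).2; omega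
    | succ N ih =>
      intro y hy
      by_cases h : y = x
      · exact ⟨0, h⟩
      · obtain ⟨k, hk⟩ := ih (t y) (by have := (ht2 y h).2; omega)
        exact ⟨k + 1, by rw [Function.iterate_succ_apply, hk]⟩
  exact fun y => this _ y le_rfl

theorem tau_pos {X : Type*} [Fintype X] (r r0 : X × X → ℝ) (hr : ∀ e, 0 ≤ r e)
    (hle : ∀ e, r0 e ≤ r e) (hi : Irreducible' r0) (x : X) : 0 < tau r x ∅ ∅ := by
  obtain ⟨t, h1, h2, h3⟩ := exists_tree r0 hi x
  rw [tau_eq]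
  apply Finset.sum_pos'
  · intro t _
    exact Finset.prod_nonneg (fun _ _ => hr _)
  · refine ⟨t, by simp [h1, h2], Finset.prod_pos ?_⟩
    intro y hy
    simp only [Finset.mem_filter, Finset.mem_univ, true_and] at hy
    exact lt_of_lt_of_le (h3 y hy) (hle _)

theorem rate_split {X : Type*} (r : X × X → ℝ) (a b : X) (hab : a ≠ b) (p m : ℝ) (x y : X) :
    ratePM r a b p m (x, y) = ratePM r a b 0 0 (x, y)
      + p * ((if x = a then 1 else 0) * (if y = b then 1 else 0))
      + m * ((if x = b then 1 else 0) * (if y = a then 1 else 0)) := by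
  unfold ratePM
  simp only [Prod.mk.injEq]
  have hba := hab.symm
  by_cases h1 : x = a <;> by_cases h2 : y = b <;> by_cases h3 : x = b <;> by_cases h4 : y = a <;>
    simp_all

/-- normalized stationary weights -/
def stat {X : Type*} [Fintype X] (r : X × X → ℝ) (x : X) : ℝ :=
  tau r x ∅ ∅ / ∑ z, tau r z ∅ ∅

theorem current_eq {X : Type*} [Fintype X] (r : X × X → ℝ) (u v : X) :
    current r u v = r (u, v) * stat r u - r (v, u) * stat r v := by
  unfold current stat
  ring

theorem stat_stationary {X : Type*} [Fintype X] (r : X × X → ℝ) (x : X) :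
    ∑ y, (r (y, x) * stat r y - r (x, y) * stat r x) = 0 := by
  have := congrArg (· / ∑ z, tau r z ∅ ∅) (tau_stationary r x)
  simp only [zero_div, Finset.sum_div] at this
  rw [← this]
  apply Finset.sum_congr rfl
  intros
  unfold stat
  ring

theorem stmt_16 {X : Type*} [Fintype X] (r : X × X → ℝ) (a b : X) (hab : a ≠ b)
    (hr : ∀ e, e ≠ (a, b) → e ≠ (b, a) → 0 ≤ r e)
    (hirr : Irreducible' (ratePM r a b 0 0))
    (u v : X) (huv : u ≠ v) (u' v' : X) (huv' : u' ≠ v') :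
    ∃ α β γ : ℝ, (β, γ) ≠ ((0 : ℝ), (0 : ℝ)) ∧
      ∀ p m : ℝ, 0 ≤ p → 0 ≤ m →
        β * current (ratePM r a b p m) u v + γ * current (ratePM r a b p m) u' v' = α := by
  set R0 := ratePM r a b 0 0 with hR0
  have hR0n : ∀ e, 0 ≤ R0 e := by
    intro e
    simp only [hR0, ratePM]
    split_ifs with h1 h2
    · exact le_rfl
    · exact le_rfl
    · exact hr e h1 h2
  set J : ℝ → ℝ → ℝ := fun p m =>
    p * stat (ratePM r a b p m) a - m * stat (ratePM r a b p m) b with hJ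
  have hsum : ∀ p m : ℝ, 0 ≤ p → 0 ≤ m → ∑ x, stat (ratePM r a b p m) x = 1 := by
    intro p m hp hm
    have hle : ∀ e, R0 e ≤ ratePM r a b p m e := by
      intro e
      simp only [hR0, ratePM]
      split_ifs <;> first | assumption | exact le_rfl
    have hpos : 0 < ∑ x, tau (ratePM r a b p m) x ∅ ∅ :=
      Finset.sum_pos (fun x _ => tau_pos _ R0 (fun e => (hR0n e).trans (hle e)) hle hirr x)
        ⟨a, Finset.mem_univ _⟩
    simp only [stat]
    rw [← Finset.sum_div, div_self hpos.ne']
  have hred : ∀ p m x, ∑ y, (R0 (y, x) * stat (ratePM r a b p m) y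
      - R0 (x, y) * stat (ratePM r a b p m) x)
      = ((if x = a then 1 else 0) - (if x = b then 1 else 0)) * J p m := by
    intro p m x
    have h := stat_stationary (ratePM r a b p m) x
    set s := stat (ratePM r a b p m) with hs
    simp only [rate_split r a b hab p m] at h
    rw [← hR0] at h
    have h' : ∀ y, (R0 (y, x) + p * ((if y = a then 1 else 0) * (if x = b then 1 else 0))
        + m * ((if y = b then 1 else 0) * (if x = a then 1 else 0))) * s y
        - (R0 (x, y) + p * ((if x = a then 1 else 0) * (if y = b then 1 else 0))
        + m * ((if x = b then 1 else 0) * (if y = a then 1 else 0))) * s x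
        = (R0 (y, x) * s y - R0 (x, y) * s x)
        + ((if y = a then p * (if x = b then 1 else 0) * s a else 0)
        + (if y = b then m * (if x = a then 1 else 0) * s b else 0)
        - (if y = b then p * (if x = a then 1 else 0) * s x else 0)
        - (if y = a then m * (if x = b then 1 else 0) * s x else 0)) := by
      intro y
      by_cases h1 : y = a
      · subst h1
        simp only [if_true, if_neg hab]; ring
      · by_cases h2 : y = b
        · subst h2
          simp only [if_true, if_neg h1]; ring
        · simp [h1, h2]
    simp only [h'] at h
    simp only [Finset.sum_add_distrib, Finset.sum_sub_distrib] at h ⊢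
    simp only [Finset.sum_ite_eq', Finset.mem_univ, if_true] at h
    simp only [hJ, ← hs]
    by_cases h1 : x = a
    · subst h1
      simp [hab] at h ⊢
      linarith
    · by_cases h2 : x = b
      · subst h2
        simp [h1] at h ⊢
        linarith
      · simp [h1, h2] at h ⊢
        linarith
  have haff : ∃ c w : X → ℝ, ∀ p m, 0 ≤ p → 0 ≤ m → ∀ x,
      stat (ratePM r a b p m) x = c x + J p m * w x := by
    have key : ∀ p m, 0 ≤ p → 0 ≤ m → ∀ (w : X → ℝ), ∑ x, w x = 0 →
        (∀ x, ∑ y, (R0 (y, x) * w y - R0 (x, y) * w x) * J p m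
          = ((if x = a then 1 else 0) - (if x = b then 1 else 0)) * J p m) → 
        ∀ x, stat (ratePM r a b p m) x = stat R0 x + J p m * w x := by
      intro p m hp hm w hw1 hw2 x
      have := ker_zero R0 hR0n hirr
        (fun x => stat (ratePM r a b p m) x - (stat R0 x + J p m * w x)) ?_ ?_ x
      · linarith
      · intro x
        have e1 := hred p m x
        have e2 := stat_stationary R0 x
        have e3 := hw2 x
        have : ∑ y, (R0 (y, x) * stat (ratePM r a b p m) y
            - R0 (x, y) * stat (ratePM r a b p m) x)
            - ∑ y, (R0 (y, x) * stat R0 y - R0 (x, y) * stat R0 x)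
            - ∑ y, (R0 (y, x) * w y - R0 (x, y) * w x) * J p m = 0 := by
          rw [e1, e2, e3]; ring
        rw [← Finset.sum_sub_distrib, ← Finset.sum_sub_distrib] at this
        rw [← this]
        apply Finset.sum_congr rfl
        intros
        ring
      · rw [Finset.sum_sub_distrib, Finset.sum_add_distrib, ← Finset.mul_sum, hw1,
          hsum p m hp hm, hsum 0 0 le_rfl le_rfl]
        ring
    by_cases hex : ∃ p m, 0 ≤ p ∧ 0 ≤ m ∧ J p m ≠ 0
    · obtain ⟨p1, m1, hp1, hm1, hJ1⟩ := hex
      refine ⟨stat R0, fun x => (stat (ratePM r a b p1 m1) x - stat R0 x) / J p1 m1, ?_⟩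
      intro p m hp hm
      apply key p m hp hm
      · rw [← Finset.sum_div, Finset.sum_sub_distrib, hsum p1 m1 hp1 hm1,
          hsum 0 0 le_rfl le_rfl]
        simp
      · intro x
        rw [← Finset.sum_mul]
        congr 1
        have e1 := hred p1 m1 x
        have e2 := stat_stationary R0 x
        rw [← mul_left_inj' hJ1, ← e1, ← sub_zero (∑ y, (R0 (y, x) * stat (ratePM r a b p1 m1) y
            - R0 (x, y) * stat (ratePM r a b p1 m1) x)), ← e2, ← Finset.sum_sub_distrib,
          Finset.sum_mul]
        apply Finset.sum_congr rfl
        intros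
        field_simp
        ring
    · push Not at hex
      refine ⟨stat R0, fun _ => 0, ?_⟩
      intro p m hp hm
      apply key p m hp hm
      · simp
      · intro x
        simp [hex p m hp hm]
  obtain ⟨c, w, hcw⟩ := haff
  have hcur : ∀ u v : X, ∃ A B : ℝ, ∀ p m, 0 ≤ p → 0 ≤ m →
      current (ratePM r a b p m) u v = A + B * J p m := by
    intro u v
    refine ⟨R0 (u, v) * c u - R0 (v, u) * c v, R0 (u, v) * w u - R0 (v, u) * w v
      + ((if u = a then 1 else 0) * (if v = b then 1 else 0)
        - (if u = b then 1 else 0) * (if v = a then 1 else 0)), ?_⟩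
    intro p m hp hm
    have hu := hcw p m hp hm u
    have hv := hcw p m hp hm v
    have : current (ratePM r a b p m) u v = R0 (u, v) * stat (ratePM r a b p m) u
        - R0 (v, u) * stat (ratePM r a b p m) v
        + ((if u = a then 1 else 0) * (if v = b then 1 else 0)
        - (if u = b then 1 else 0) * (if v = a then 1 else 0)) * J p m := by
      rw [current_eq]
      simp only [hJ]
      set s := stat (ratePM r a b p m) with hs
      rw [rate_split r a b hab p m u v, rate_split r a b hab p m v u, ← hR0]
      have i1 : ∀ x z : X, (if x = z then (1:ℝ) else 0) * s x = (if x = z then 1 else 0) * s z := by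
        intro x z
        by_cases h : x = z <;> simp [h]
      linear_combination p * (if v = b then 1 else 0) * i1 u a
        + m * (if v = a then 1 else 0) * i1 u b
        - p * (if u = b then 1 else 0) * i1 v a
        - m * (if u = a then 1 else 0) * i1 v b
    rw [this, hu, hv]
    ring
  obtain ⟨A, B, h1⟩ := hcur u v
  obtain ⟨A', B', h2⟩ := hcur u' v'
  by_cases hB : B = 0
  · refine ⟨A, 1, 0, by simp, ?_⟩
    intro p m hp hm
    rw [h1 p m hp hm, hB]
    ring
  · refine ⟨B' * A - B * A', B', -B, by simp [hB], ?_⟩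
    intro p m hp hm
    rw [h1 p m hp hm, h2 p m hp hm]
    ring
end
end

section
/- Two pinned edges, rank at least 3: assume the three conditioned polynomials τ_a^{∖{+1,−2}∥{−1,+2}}, τ_b^{∖{−1,+2}∥{+1,−2}} and τ_c^{∖{+1,+2}∥{−1,−2}} are all strictly positive. Then the vectors T_a, T_b, T_c ∈ ℝ⁹ are linearly independent, so the ℝ-linear span of {T_x : x ∈ X} has dimension at least 3. A key step: the 3×3 minor of (T_a, T_b, T_c) formed by the last three components (those indexed by ∖{+1,−2}∥{−1,+2}, ∖{−1,+2}∥{+1,−2} and ∖{+1,+2}∥{−1,−2}) has determinant equal to τ_a^{∖{+1,−2}∥{−1,+2}} · τ_b^{∖{−1,+2}∥{+1,−2}} · τ_c^{∖{+1,+2}∥{−1,−2}} > 0, because the conditioned polynomial τ_x^{∖A∥B} vanishes whenever some edge of B has source x. -/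
open scoped Classical

noncomputable section

/-- The spanning-tree 9-vector `T_x` for two pinned edges `+1 = (a,b)`, `−1 = (b,a)`,
`+2 = (c,d)`, `−2 = (d,c)`. -/
def tauVec9 {X : Type*} [Fintype X] (r : X × X → ℝ) (a b c d : X) (x : X) : Fin 9 → ℝ :=
  ![tau r x {(a, b), (b, a), (c, d), (d, c)} ∅,
    tau r x {(b, a), (c, d), (d, c)} {(a, b)},
    tau r x {(a, b), (c, d), (d, c)} {(b, a)},
    tau r x {(a, b), (b, a), (d, c)} {(c, d)},
    tau r x {(a, b), (b, a), (c, d)} {(d, c)},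
    tau r x {(b, a), (d, c)} {(a, b), (c, d)},
    tau r x {(a, b), (d, c)} {(b, a), (c, d)},
    tau r x {(b, a), (c, d)} {(a, b), (d, c)},
    tau r x {(a, b), (c, d)} {(b, a), (d, c)}]

theorem tau_eq_zero_of_source {X : Type*} [Fintype X] (r : X × X → ℝ) (x y : X)
    (A B : Set (X × X)) (h : (x, y) ∈ B) : tau r x A B = 0 := by
  unfold tau
  refine Finset.sum_eq_zero fun t _ => if_neg ?_
  rintro ⟨_, _, hB⟩
  exact (hB h).1 rfl

theorem stmt_18 {X : Type*} [Fintype X] (r : X × X → ℝ) (hr : ∀ e, 0 ≤ r e)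
    (a b c d : X) (hab : a ≠ b) (hac : a ≠ c) (had : a ≠ d)
    (hbc : b ≠ c) (hbd : b ≠ d) (hcd : c ≠ d)
    (h1 : 0 < r (a, b)) (h2 : 0 < r (b, a)) (h3 : 0 < r (c, d)) (h4 : 0 < r (d, c))
    (ha : 0 < tau r a {(a, b), (d, c)} {(b, a), (c, d)})
    (hb : 0 < tau r b {(b, a), (c, d)} {(a, b), (d, c)})
    (hc : 0 < tau r c {(a, b), (c, d)} {(b, a), (d, c)}) :
    (Matrix.det !![tauVec9 r a b c d a 6, tauVec9 r a b c d b 6, tauVec9 r a b c d c 6;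
                   tauVec9 r a b c d a 7, tauVec9 r a b c d b 7, tauVec9 r a b c d c 7;
                   tauVec9 r a b c d a 8, tauVec9 r a b c d b 8, tauVec9 r a b c d c 8]
        = tau r a {(a, b), (d, c)} {(b, a), (c, d)}
          * tau r b {(b, a), (c, d)} {(a, b), (d, c)}
          * tau r c {(a, b), (c, d)} {(b, a), (d, c)} ∧
      0 < Matrix.det !![tauVec9 r a b c d a 6, tauVec9 r a b c d b 6, tauVec9 r a b c d c 6;
                   tauVec9 r a b c d a 7, tauVec9 r a b c d b 7, tauVec9 r a b c d c 7;
                   tauVec9 r a b c d a 8, tauVec9 r a b c d b 8, tauVec9 r a b c d c 8]) ∧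
    LinearIndependent ℝ ![tauVec9 r a b c d a, tauVec9 r a b c d b, tauVec9 r a b c d c] ∧
    3 ≤ Module.finrank ℝ (Submodule.span ℝ (Set.range (tauVec9 r a b c d))) := by
  have e1 : tauVec9 r a b c d b 6 = 0 := tau_eq_zero_of_source r b a _ _ (by simp)
  have e2 : tauVec9 r a b c d c 6 = 0 := tau_eq_zero_of_source r c d _ _ (by simp)
  have e3 : tauVec9 r a b c d a 7 = 0 := tau_eq_zero_of_source r a b _ _ (by simp)
  have e4 : tauVec9 r a b c d b 8 = 0 := tau_eq_zero_of_source r b a _ _ (by simp)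
  have f1 : tauVec9 r a b c d a 6 = tau r a {(a, b), (d, c)} {(b, a), (c, d)} := rfl
  have f2 : tauVec9 r a b c d b 7 = tau r b {(b, a), (c, d)} {(a, b), (d, c)} := rfl
  have f3 : tauVec9 r a b c d c 8 = tau r c {(a, b), (c, d)} {(b, a), (d, c)} := rfl
  rw [← f1] at ha
  rw [← f2] at hb
  rw [← f3] at hc
  rw [← f1, ← f2, ← f3]
  have hdet : Matrix.det
      !![tauVec9 r a b c d a 6, tauVec9 r a b c d b 6, tauVec9 r a b c d c 6;
         tauVec9 r a b c d a 7, tauVec9 r a b c d b 7, tauVec9 r a b c d c 7;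
         tauVec9 r a b c d a 8, tauVec9 r a b c d b 8, tauVec9 r a b c d c 8]
      = tauVec9 r a b c d a 6 * tauVec9 r a b c d b 7 * tauVec9 r a b c d c 8 := by
    rw [Matrix.det_fin_three]
    simp [e1, e2, e3, e4]
  have hli : LinearIndependent ℝ
      ![tauVec9 r a b c d a, tauVec9 r a b c d b, tauVec9 r a b c d c] := by
    rw [Fintype.linearIndependent_iff]
    intro g hg
    rw [Fin.sum_univ_three] at hg
    have k6 := congrFun hg 6
    have k7 := congrFun hg 7
    have k8 := congrFun hg 8
    simp only [Matrix.cons_val_zero, Matrix.cons_val_one, Matrix.cons_val, Pi.add_apply,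
      Pi.smul_apply, smul_eq_mul, Pi.zero_apply, e1, e2, e3, e4, mul_zero, add_zero,
      zero_add] at k6 k7 k8
    have g0 : g 0 = 0 := (mul_eq_zero.mp k6).resolve_right ha.ne'
    rw [g0, zero_mul, zero_add] at k8
    have g2 : g 2 = 0 := (mul_eq_zero.mp k8).resolve_right hc.ne'
    rw [g2, zero_mul, add_zero] at k7
    have g1 : g 1 = 0 := (mul_eq_zero.mp k7).resolve_right hb.ne'
    intro i
    fin_cases i
    · exact g0
    · exact g1
    · exact g2
  refine ⟨⟨hdet, ?_⟩, hli, ?_⟩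
  · rw [hdet]
    exact mul_pos (mul_pos ha hb) hc
  · have h := finrank_span_eq_card hli
    rw [Fintype.card_fin] at h
    refine h.symm.le.trans ?_
    apply Submodule.finrank_mono
    apply Submodule.span_mono
    rintro _ ⟨i, rfl⟩
    fin_cases i
    · exact ⟨a, rfl⟩
    · exact ⟨b, rfl⟩
    · exact ⟨c, rfl⟩
end
end
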